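/- arXiv:1903.06064 — 2 statements merged into one kernel-verified Lean document; each statement's English description precedes it below -/
import Mathlib

section
/- Let $A = (a_{11}, \ldots, a_{1n}) \in \mathbb{Z}^{1 \times n}$ have all entries positive with $\gcd(a_{11}, \ldots, a_{1n}) = 1$, and let $b \in \mathbb{Z}$ satisfy $b > G(A)$. Then the equation $a_{11}x_1 + \cdots + a_{1n}x_n = b$ has a solution $x \in \mathbb{Z}^n_{\geq 0}$ with all coordinates nonnegative integers. -/
/-- A linear congruence `c * x ≡ b [ZMOD g]` with `gcd g c ∣ b` has a solution in
`[0, g / gcd g c)`. -/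
theorem exists_small_solution_of_gcd_dvd {g c b : ℤ} (hg : 0 < g) (hb : (Int.gcd g c : ℤ) ∣ b) :
    ∃ x : ℤ, 0 ≤ x ∧ x < g / Int.gcd g c ∧ g ∣ b - c * x := by
  obtain ⟨k, hk⟩ := hb
  obtain ⟨g', hg'⟩ := Int.gcd_dvd_left g c
  obtain ⟨c', hc'⟩ := Int.gcd_dvd_right g c
  have hbez := Int.gcd_eq_gcd_ab g c
  have hd : (0 : ℤ) < Int.gcd g c := by exact_mod_cast Int.gcd_pos_of_ne_zero_left c hg.ne'
  have hdiv : g / Int.gcd g c = g' := Int.ediv_eq_of_eq_mul_right hd.ne' hg'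
  rw [hdiv]
  generalize (Int.gcd g c : ℤ) = d at *
  generalize Int.gcdA g c = u at *
  generalize Int.gcdB g c = v at *
  have hg'pos : 0 < g' := by
    rw [hg'] at hg
    exact pos_of_mul_pos_right hg hd.le
  refine ⟨(v * k) % g', Int.emod_nonneg _ hg'pos.ne', Int.emod_lt_of_pos _ hg'pos,
    u * k + c' * (v * k / g'), ?_⟩
  rw [Int.emod_def]
  linear_combination hk + k * hbez + g' * (v * k / g') * hc' - c' * (v * k / g') * hg'

/-- If `f i` are the successive gcds of the positive integers `a i`, then every multiple `b` of the
last gcd that exceeds the Brauer bound is a nonnegative integer combination of the `a i`. -/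
theorem exists_nonneg_sum_eq_of_brauer_lt (n : ℕ) (a f : Fin (n + 1) → ℤ) (hpos : ∀ i, 0 < a i)
    (hfpos : ∀ i, 0 < f i) (hf0 : f 0 = a 0)
    (hf : ∀ i : Fin n, f i.succ = Int.gcd (f i.castSucc) (a i.succ))
    (b : ℤ) (hdvd : f (Fin.last n) ∣ b)
    (hb : (∑ i : Fin n, a i.succ * (f i.castSucc / f i.succ)) - (∑ i, a i) < b) :
    ∃ x : Fin (n + 1) → ℤ, (∀ i, 0 ≤ x i) ∧ ∑ i, a i * x i = b := by
  induction n generalizing b with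
  | zero =>
    obtain ⟨k, rfl⟩ := hdvd
    have h0 := hpos 0
    simp only [Fin.last_zero, hf0, Finset.univ_eq_empty, Finset.sum_empty, Fin.sum_univ_succ] at hb
    refine ⟨fun _ => k, fun _ => ?_, by simp [hf0]⟩
    by_contra! hk
    nlinarith
  | succ n ih =>
    have hlast := hf (Fin.last n)
    rw [Fin.succ_last] at hlast
    rw [hlast] at hdvd
    obtain ⟨x, hx0, hxlt, hx⟩ := exists_small_solution_of_gcd_dvd (hfpos _) hdvd
    rw [← hlast] at hxlt
    rw [Fin.sum_univ_castSucc, Fin.sum_univ_castSucc (f := a)] at hb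
    simp only [Fin.succ_last] at hb
    have hal := hpos (Fin.last (n + 1))
    obtain ⟨y, hy0, hy⟩ := ih (fun i => a i.castSucc) (fun i => f i.castSucc)
      (fun i => hpos _) (fun i => hfpos _) hf0 (fun i => hf i.castSucc)
      (b - a (Fin.last (n + 1)) * x) hx (by
        simp only [Fin.succ_castSucc] at hb
        have := mul_le_mul_of_nonneg_left (Int.add_one_le_of_lt hxlt) hal.le
        linarith)
    refine ⟨Fin.snoc y x, fun i => ?_, ?_⟩
    · refine Fin.lastCases ?_ (fun i => ?_) i
      · simpa using hx0
      · simpa using hy0 i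
    · rw [Fin.sum_univ_castSucc]
      simp only [Fin.snoc_castSucc, Fin.snoc_last]
      linarith


/-- **Corollary: Brimkov-type bound.** Let `A = (a₁, …, a_{n+1}) ∈ ℤ^{1×(n+1)}`
have positive entries with `gcd = 1`, let `f i` be the gcd of the first entries up to `i`,
and let `G(A) = ∑ a_{i+1} (f_i / f_{i+1}) - ∑ a_i`.  If `b > G(A)` then `∑ a_i x_i = b` has
a nonnegative integer solution. -/
theorem stmt1 (n : ℕ) (hn : 0 < n) (a : Fin (n + 1) → ℤ)
    (hpos : ∀ i, 0 < a i)
    (hgcd : Finset.univ.gcd a = 1)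
    (f : Fin (n + 1) → ℤ) (hf : ∀ i, f i = (Finset.Iic i).gcd a)
    (b : ℤ)
    (hb : (∑ i : Fin n, a i.succ * (f i.castSucc / f i.succ)) - (∑ i, a i) < b) :
    ∃ x : Fin (n + 1) → ℤ, (∀ i, 0 ≤ x i) ∧ ∑ i, a i * x i = b := by
  have hsucc (i : Fin n) : f i.succ = Int.gcd (f i.castSucc) (a i.succ) := by
    have hIic : Finset.Iic i.succ = insert i.succ (Finset.Iic i.castSucc) := by
      ext j
      simp only [Finset.mem_Iic, Finset.mem_insert, Fin.le_def, Fin.ext_iff, Fin.val_succ,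
        Fin.val_castSucc]
      omega
    rw [hf, hf, hIic, Finset.gcd_insert, Int.coe_gcd, gcd_comm]
  have hf0 : f 0 = a 0 := by
    have hIic : Finset.Iic (0 : Fin (n + 1)) = {0} := by
      ext j
      simp
    rw [hf, hIic, Finset.gcd_singleton, Int.normalize_of_nonneg (hpos 0).le]
  have hfpos (i : Fin (n + 1)) : 0 < f i := by
    refine Fin.cases ?_ (fun i => ?_) i
    · exact hf0 ▸ hpos 0
    · rw [hsucc]
      exact_mod_cast Int.gcd_pos_of_ne_zero_right _ (hpos i.succ).ne'
  have hlast : f (Fin.last n) = 1 := by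
    have hIic : Finset.Iic (Fin.last n) = Finset.univ := by
      ext j
      simp [Fin.le_last]
    rw [hf, hIic, hgcd]
  exact exists_nonneg_sum_eq_of_brauer_lt n a f hpos hfpos hf0 hsucc b
    (hlast ▸ one_dvd b) hb
end

section
/- Let $A = (a_{11}, \ldots, a_{1n}) \in \mathbb{Z}^{1 \times n}$ have positive entries with $\gcd(a_{11}, \ldots, a_{1n}) = 1$, and set $f_1 = a_{11}$, $f_i = \gcd(a_{11}, \ldots, a_{1i})$ for $2 \leq i \leq n$. Then the box $\mathcal{B}(\Lambda(A))$ associated to the lattice $\Lambda(A) = \{x \in \mathbb{Z}^{n-1} : a_{12}x_1 + \cdots + a_{1n}x_{n-1} \equiv 0 \pmod{a_{11}}\}$ equals $\left[0, \frac{f_1}{f_2}\right) \times \left[0, \frac{f_2}{f_3}\right) \times \cdots \times \left[0, \frac{f_{n-1}}{f_n}\right)$; equivalently, the diagonal entries of the unique lower-triangular basis of $\Lambda(A)$ are $v_{ii} = f_i/f_{i+1}$ for $i = 1, \ldots, n-1$. -/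
/-- **Bézout's identity** for a finite family of integers. -/
theorem Finset.exists_gcd_eq_sum_mul {ι : Type*} [Fintype ι] [DecidableEq ι]
    (s : Finset ι) (a : ι → ℤ) :
    ∃ b : ι → ℤ, (∀ k ∉ s, b k = 0) ∧ s.gcd a = ∑ k, a k * b k := by
  induction s using Finset.induction_on with
  | empty => exact ⟨0, by simp, by simp⟩
  | insert m s _ ih =>
    obtain ⟨b, hb, hsum⟩ := ih
    refine ⟨fun k => (Pi.single m (Int.gcdA (a m) (s.gcd a)) : ι → ℤ) k +
      b k * Int.gcdB (a m) (s.gcd a), fun k hk => ?_, ?_⟩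
    · rw [Finset.mem_insert, not_or] at hk
      simp [hk.1, hb k hk.2]
    · rw [Finset.gcd_insert, ← Int.coe_gcd, Int.gcd_eq_gcd_ab]
      simp only [mul_add, Finset.sum_add_distrib, ← mul_assoc, ← Finset.sum_mul, ← hsum]
      simp [Pi.single_apply]

/-- A row combination of a lower-triangular matrix with nonzero diagonal that vanishes in
all columns after the `i`-th involves no row after the `i`-th. -/
theorem Matrix.coeff_eq_zero_of_lowerTriangular {R : Type*} [CommRing R] [NoZeroDivisors R]
    {n : ℕ} {V : Matrix (Fin n) (Fin n) R} (htri : ∀ i j, i < j → V i j = 0)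
    (hdiag : ∀ i, V i i ≠ 0) {c : Fin n → R} {i : Fin n}
    (hc : ∀ j, i < j → ∑ r, c r * V r j = 0) (r : Fin n) (hr : i < r) : c r = 0 := by
  induction r using WellFoundedGT.induction with
  | ind r ih =>
    have h := hc r hr
    rw [Finset.sum_eq_single r] at h
    · exact (mul_eq_zero.mp h).resolve_right (hdiag r)
    · intro s _ hs
      rcases lt_or_gt_of_ne hs with hlt | hgt
      · rw [htri s r hlt, mul_zero]
      · rw [ih s hgt (hr.trans hgt), zero_mul]
    · simp


/-- **Lemma: shape of the box.** Let `a = (a₀, …, aₙ) ∈ ℤ^{1×(n+1)}` have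
positive entries with gcd `1`, and let `f i = gcd(a₀, …, a_i)`. Then the diagonal entries
of the unique lower-triangular basis matrix `V` of the lattice
`Λ(A) = {x ∈ ℤⁿ : a₀ ∣ a₁ x₁ + ⋯ + aₙ xₙ}` are `V i i = f i / f (i+1)`, i.e. the box
`B(Λ(A))` is `[0, f₀/f₁) × ⋯ × [0, f_{n-1}/fₙ)`. -/
theorem stmt11 (n : ℕ) (hn : 0 < n) (a : Fin (n + 1) → ℤ)
    (hpos : ∀ i, 0 < a i)
    (hgcd : Finset.univ.gcd a = 1)
    (f : Fin (n + 1) → ℤ) (hf : ∀ i, f i = (Finset.Iic i).gcd a)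
    (V : Matrix (Fin n) (Fin n) ℤ)
    (htri : ∀ i j, i < j → V i j = 0)
    (hdiag : ∀ i, 0 < V i i)
    (hoff : ∀ i j, j < i → 0 ≤ V i j ∧ V i j < V j j)
    (hindep : LinearIndependent ℤ (fun i => V i))
    (hbasis : ∀ x : Fin n → ℤ,
      (a 0 ∣ ∑ j, a j.succ * x j) ↔ ∃ c : Fin n → ℤ, x = ∑ r, c r • V r) :
    ∀ i : Fin n, (V i i : ℚ) = (f i.castSucc : ℚ) / (f i.succ : ℚ) := by
  intro i
  have hf_dvd : ∀ k m, m ≤ k → f k ∣ a m := fun k m hm => by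
    rw [hf]
    exact Finset.gcd_dvd (Finset.mem_Iic.mpr hm)
  have hf_pos : ∀ k, 0 < f k := fun k => by
    refine lt_of_le_of_ne ?_ fun h => ?_
    · rw [hf, ← Finset.normalize_gcd]
      exact Int.nonneg_of_normalize_eq_self (normalize_idem _)
    · exact (hpos k).ne' (zero_dvd_iff.mp (h ▸ hf_dvd k k le_rfl))
  have hIic : Finset.Iic i.succ = insert i.succ (Finset.Iic i.castSucc) := by
    ext k
    simp only [Finset.mem_Iic, Finset.mem_insert, Fin.le_def, Fin.ext_iff, Fin.val_succ,
      Fin.val_castSucc]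
    omega
  have hstep : f i.succ = Int.gcd (f i.castSucc) (a i.succ) := by
    rw [hf, hf, hIic, Finset.gcd_insert, ← Int.coe_gcd, Int.gcd_comm]
  obtain ⟨p, hp⟩ : f i.succ ∣ f i.castSucc := hstep ▸ Int.gcd_dvd_left ..
  obtain ⟨q, hq⟩ : f i.succ ∣ a i.succ := hf_dvd _ _ le_rfl
  have hd := hf_pos i.succ
  have hp_pos : 0 < p := pos_of_mul_pos_right (hp ▸ hf_pos i.castSucc) hd.le
  have hcop : IsCoprime p q := by
    rw [Int.isCoprime_iff_gcd_eq_one]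
    rw [hp, hq, Int.gcd_mul_left, Nat.cast_mul, Int.natCast_natAbs, abs_of_pos hd] at hstep
    exact_mod_cast (mul_eq_left₀ hd.ne').mp hstep.symm
  have hp_dvd : p ∣ V i i := by
    have hrow : a 0 ∣ ∑ j, a j.succ * V i j :=
      (hbasis (V i)).mpr ⟨Pi.single i 1, by
        ext j
        simp only [Finset.sum_apply, Pi.smul_apply]
        simp [Pi.single_apply]⟩
    have hsum := (hf_dvd i.castSucc 0 (Fin.zero_le _)).trans hrow
    rw [← Finset.add_sum_erase _ _ (Finset.mem_univ i)] at hsum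
    have hrest : f i.castSucc ∣ ∑ j ∈ Finset.univ.erase i, a j.succ * V i j := by
      refine Finset.dvd_sum fun j hj => ?_
      rcases lt_or_gt_of_ne (Finset.ne_of_mem_erase hj) with hlt | hgt
      · exact (hf_dvd _ _ (Fin.succ_le_castSucc_iff.mpr hlt)).mul_right _
      · simp [htri i j hgt]
    have hmul := (dvd_add_left hrest).mp hsum
    rw [hp, hq, mul_assoc] at hmul
    exact hcop.dvd_of_dvd_mul_left ((mul_dvd_mul_iff_left hd.ne').mp hmul)
  have hdvd_p : V i i ∣ p := by
    obtain ⟨b, hb, hsum⟩ := Finset.exists_gcd_eq_sum_mul (Finset.Iic i.castSucc) a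
    rw [← hf, Fin.sum_univ_succ] at hsum
    have hb_zero : ∀ j, i ≤ j → b j.succ = 0 := fun j hij => hb _ <| by
      rw [Finset.mem_Iic, not_le]
      exact Fin.castSucc_lt_succ_iff.mpr hij
    obtain ⟨c, hc⟩ := (hbasis fun j => (Pi.single i p : Fin n → ℤ) j - b j.succ * q).mp <| by
      refine ⟨b 0 * q, ?_⟩
      simp only [mul_sub, Finset.sum_sub_distrib, ← mul_assoc, ← Finset.sum_mul]
      rw [← sub_eq_iff_eq_add'.mpr hsum]
      simp only [Pi.single_apply, mul_ite, mul_zero, Finset.sum_ite_eq', Finset.mem_univ,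
        if_true, hp, hq]
      ring
    have hcol : ∀ j, ∑ r, c r * V r j = (Pi.single i p : Fin n → ℤ) j - b j.succ * q :=
      fun j => by simpa using (congrFun hc j).symm
    have hc_zero := Matrix.coeff_eq_zero_of_lowerTriangular htri (fun r => (hdiag r).ne')
      (c := c) (i := i) fun j hj => by rw [hcol, hb_zero j hj.le]; simp [hj.ne']
    have hcol_i := hcol i
    rw [hb_zero i le_rfl, Finset.sum_eq_single i] at hcol_i
    · exact ⟨c i, by simpa [mul_comm, eq_comm] using hcol_i⟩
    · intro r _ hr
      rcases lt_or_gt_of_ne hr with hlt | hgt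
      · rw [htri r i hlt, mul_zero]
      · rw [hc_zero r hgt, zero_mul]
    · simp
  have hVp : V i i = p := Int.dvd_antisymm (hdiag i).le hp_pos.le hdvd_p hp_dvd
  rw [eq_div_iff (by exact_mod_cast hd.ne'), hVp, hp]
  push_cast
  ring
end
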